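/- Let X be a random vector in ℝ^d, b ∈ ℝ^d, and let ν be a Lévy measure with ∫_{‖u‖≤1} ‖u‖ ν(du) < ∞ and polar decomposition ν(du) = 1_{(0,∞)}(r) 1_{S^{d−1}}(x) (k_x(r)/r) dr σ(dx), where σ is a finite positive measure on S^{d−1} and k_x(r) ≥ 0 is continuous and nonincreasing in r ∈ (0,∞), continuous in x ∈ S^{d−1}, with lim_{ε→0⁺} ε k_x(ε) = 0 and lim_{R→∞} k_x(R) = 0 for every x, and ∫_0^∞ min(1,r) max_{x∈S^{d−1}} k_x(r) dr/r < ∞. Assume that for every sequence (x_n) in S^{d−1} converging to x, lim_n lim_{R→∞} V_a^R(k_{x_n} − k_x) = 0 for all a > 0, where V_a^R denotes total variation on [a,R]. Let ν̃ be the positive measure ν̃(du) = 1_{(0,∞)}(r) 1_{S^{d−1}}(x) (−dk_x(r)) σ(dx), and assume ∫ min(1,‖u‖) ν̃(du) < ∞. Set b₀ = b − ∫_{‖u‖≤1} u ν(du). Then the identity E[⟨X, ∇f(X)⟩] = ⟨b₀, E[∇f(X)]⟩ + E[∫_{ℝ^d} (f(X+u) − f(X)) ν̃(du)] holds for every f ∈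 S(ℝ^d) if and only if the characteristic function of X equals φ(ξ) = exp( i⟨b,ξ⟩ + ∫_{ℝ^d} (e^{i⟨ξ,u⟩} − 1 − i⟨ξ,u⟩ 1_{‖u‖≤1}) ν(du) ), i.e., X is self-decomposable with parameter b, no Gaussian component and Lévy measure ν. -/

import Mathlib

open MeasureTheory ProbabilityTheory Filter Set
open scoped RealInnerProductSpace ENNReal NNReal Topology

noncomputable section

/-- A Lévy measure on `ℝ^d`. -/
def IsLevyMeasure {d : ℕ} (ν : Measure (EuclideanSpace ℝ (Fin d))) : Prop :=
  ν {0} = 0 ∧ ∫⁻ u, ENNReal.ofReal (min 1 (‖u‖ ^ 2)) ∂ν < ⊤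

/-- The characteristic function of a measure on `ℝ^d`. -/
def charFn {d : ℕ} (μ : Measure (EuclideanSpace ℝ (Fin d)))
    (ξ : EuclideanSpace ℝ (Fin d)) : ℂ :=
  ∫ x, Complex.exp (Complex.I * (⟪ξ, x⟫ : ℂ)) ∂μ

/-- If `τ` is carried by `(0,∞)` with finite tails, then it is `σ`-finite. -/
lemma sigmaFinite_of_measure_Ioi_lt_top {τ : Measure ℝ} (h0 : τ (Iic 0) = 0)
    (h : ∀ r : ℝ, 0 < r → τ (Ioi r) < ⊤) : SigmaFinite τ := by
  refine ⟨⟨{ set := fun n => Iic 0 ∪ Ioi (1 / ((n : ℝ) + 1)), set_mem := fun _ => trivial,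
             finite := fun n => ?_, spanning := ?_ }⟩⟩
  · refine (measure_union_le _ _).trans_lt ?_
    rw [h0, zero_add]
    exact h _ (by positivity)
  · ext r
    simp only [mem_iUnion, mem_union, mem_Iic, mem_Ioi, mem_univ, iff_true]
    rcases le_or_gt r 0 with hr | hr
    · exact ⟨0, Or.inl hr⟩
    · obtain ⟨n, hn⟩ := exists_nat_one_div_lt hr
      exact ⟨n, Or.inr hn⟩

/-- The Lebesgue–Stieltjes measure of a nonincreasing function vanishing at infinity
recovers this function through its tails. -/
lemma measure_Ioi_eq_of_measure_Ioc {τ : Measure ℝ} {k : ℝ → ℝ}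
    (hτ : ∀ a c : ℝ, 0 < a → a ≤ c → τ (Ioc a c) = ENNReal.ofReal (k a - k c))
    (hk : Tendsto k atTop (𝓝 0)) {r : ℝ} (hr : 0 < r) :
    τ (Ioi r) = ENNReal.ofReal (k r) := by
  have h1 : Tendsto (fun n : ℕ => τ (Ioc r (r + n))) atTop (𝓝 (τ (⋃ n : ℕ, Ioc r (r + n)))) := by
    refine tendsto_measure_iUnion_atTop fun m n hmn => Ioc_subset_Ioc_right ?_
    have : (m : ℝ) ≤ n := by exact_mod_cast hmn
    linarith
  have h2 : (⋃ n : ℕ, Ioc r (r + n)) = Ioi r := by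
    ext s
    simp only [mem_iUnion, mem_Ioc, mem_Ioi]
    refine ⟨fun ⟨n, hn⟩ => hn.1, fun hs => ?_⟩
    obtain ⟨n, hn⟩ := exists_nat_ge (s - r)
    exact ⟨n, hs, by linarith⟩
  rw [h2] at h1
  refine tendsto_nhds_unique h1 ?_
  have h3 : ∀ n : ℕ, τ (Ioc r (r + n)) = ENNReal.ofReal (k r - k (r + n)) := fun n =>
    hτ _ _ hr (by simp)
  simp_rw [h3]
  have h4 : Tendsto (fun n : ℕ => k r - k (r + n)) atTop (𝓝 (k r - 0)) :=
    tendsto_const_nhds.sub (hk.comp (tendsto_atTop_add_const_left _ _ tendsto_natCast_atTop_atTop))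
  rw [sub_zero] at h4
  exact (ENNReal.continuous_ofReal.tendsto _).comp h4

/-- Scale invariance of the measure `dr / r`. -/
lemma lintegral_Ioo_mul_ofReal_inv {g : ℝ → ℝ≥0∞} (hg : Measurable g) {s : ℝ} (hs : 0 < s) :
    ∫⁻ r in Ioo 0 s, g r * ENNReal.ofReal r⁻¹
      = ∫⁻ v in Ioo (0 : ℝ) 1, g (v * s) * ENNReal.ofReal v⁻¹ := by
  have hm : Measurable fun r : ℝ => (Ioo 0 s).indicator (fun r => g r * ENNReal.ofReal r⁻¹) r :=
    (hg.mul (by fun_prop)).indicator measurableSet_Ioo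
  rw [← lintegral_indicator measurableSet_Ioo, ← lintegral_indicator measurableSet_Ioo]
  conv_lhs => rw [← Real.smul_map_volume_mul_left hs.ne', lintegral_smul_measure,
    lintegral_map hm (by fun_prop)]
  have hm' : Measurable fun v : ℝ =>
      (Ioo 0 s).indicator (fun r => g r * ENNReal.ofReal r⁻¹) (s * v) :=
    hm.comp (measurable_const_mul s)
  rw [smul_eq_mul, ← lintegral_const_mul _ hm']
  refine lintegral_congr fun v => ?_
  by_cases hv : v ∈ Ioo (0 : ℝ) 1
  · have : s * v ∈ Ioo 0 s := ⟨mul_pos hs hv.1, by nlinarith [hv.2]⟩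
    rw [indicator_of_mem hv, indicator_of_mem this, abs_of_pos hs, mul_inv,
      ENNReal.ofReal_mul (by positivity), mul_left_comm, ← mul_assoc (ENNReal.ofReal s),
      ← ENNReal.ofReal_mul hs.le, mul_inv_cancel₀ hs.ne', ENNReal.ofReal_one, one_mul, mul_comm s]
  · have : s * v ∉ Ioo 0 s := fun h => hv ⟨by nlinarith [h.1], by nlinarith [h.2]⟩
    rw [indicator_of_notMem hv, indicator_of_notMem this, mul_zero]

/-- Integration against `k(r) dr / r` in terms of the Lebesgue–Stieltjes measure of `k`. -/
lemma lintegral_mul_ofReal_div_eq {τ : Measure ℝ} {k : ℝ → ℝ}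
    (hτ : ∀ a c : ℝ, 0 < a → a ≤ c → τ (Ioc a c) = ENNReal.ofReal (k a - k c))
    (hτ0 : τ (Iic 0) = 0) (hk : Tendsto k atTop (𝓝 0))
    {g : ℝ → ℝ≥0∞} (hg : Measurable g) :
    ∫⁻ r in Ioi (0 : ℝ), g r * ENNReal.ofReal (k r / r)
      = ∫⁻ s, (∫⁻ v in Ioo (0 : ℝ) 1, g (v * s) * ENNReal.ofReal v⁻¹) ∂τ := by
  have hIoi : ∀ r : ℝ, 0 < r → τ (Ioi r) = ENNReal.ofReal (k r) := fun r hr =>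
    measure_Ioi_eq_of_measure_Ioc hτ hk hr
  have := sigmaFinite_of_measure_Ioi_lt_top hτ0 fun r hr => by
    rw [hIoi r hr]; exact ENNReal.ofReal_lt_top
  have hpos : ∀ᵐ s ∂τ, 0 < s := by
    rw [ae_iff]
    convert hτ0 using 2
    ext s; simp
  have hmeas : Measurable fun p : ℝ × ℝ =>
      {p : ℝ × ℝ | p.1 < p.2}.indicator (fun p => g p.1 * ENNReal.ofReal p.1⁻¹) p :=
    Measurable.indicator (by fun_prop) (measurableSet_lt measurable_fst measurable_snd)
  calc ∫⁻ r in Ioi (0 : ℝ), g r * ENNReal.ofReal (k r / r)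
      = ∫⁻ r in Ioi (0 : ℝ), ∫⁻ s,
          {p : ℝ × ℝ | p.1 < p.2}.indicator (fun p => g p.1 * ENNReal.ofReal p.1⁻¹) (r, s) ∂τ := by
        refine setLIntegral_congr_fun measurableSet_Ioi fun r (hr : 0 < r) => ?_
        have : (fun s => {p : ℝ × ℝ | p.1 < p.2}.indicator
            (fun p => g p.1 * ENNReal.ofReal p.1⁻¹) (r, s))
            = (Ioi r).indicator fun _ => g r * ENNReal.ofReal r⁻¹ := by
          ext s; simp [indicator]
        simp only [this]
        rw [lintegral_indicator_const measurableSet_Ioi, hIoi r hr, div_eq_mul_inv,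
          ENNReal.ofReal_mul' (by positivity), mul_assoc, mul_comm (ENNReal.ofReal (k r))]
    _ = ∫⁻ s, (∫⁻ r in Ioi (0 : ℝ),
          {p : ℝ × ℝ | p.1 < p.2}.indicator (fun p => g p.1 * ENNReal.ofReal p.1⁻¹) (r, s)) ∂τ :=
        lintegral_lintegral_swap hmeas.aemeasurable
    _ = ∫⁻ s, (∫⁻ v in Ioo (0 : ℝ) 1, g (v * s) * ENNReal.ofReal v⁻¹) ∂τ := by
        refine lintegral_congr_ae (hpos.mono fun s hs => ?_)
        dsimp only
        rw [← lintegral_Ioo_mul_ofReal_inv hg hs]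
        have : (fun r => {p : ℝ × ℝ | p.1 < p.2}.indicator
            (fun p => g p.1 * ENNReal.ofReal p.1⁻¹) (r, s))
            = (Iio s).indicator fun r => g r * ENNReal.ofReal r⁻¹ := by
          ext r; simp [indicator]
        rw [this, lintegral_indicator measurableSet_Iio, Measure.restrict_restrict measurableSet_Iio,
          Iio_inter_Ioi]


section Stein

set_option linter.unusedSectionVars false

variable {E : Type*} [NormedAddCommGroup E] [InnerProductSpace ℝ E]

/-- The character `x ↦ exp (i ⟨ξ, x⟩)`. -/
def wave (ξ x : E) : ℂ := Complex.exp (Complex.I * ((⟪ξ, x⟫ : ℝ) : ℂ))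

lemma norm_wave (ξ x : E) : ‖wave ξ x‖ = 1 := Complex.norm_exp_I_mul_ofReal _

lemma wave_add (ξ x y : E) : wave ξ (x + y) = wave ξ x * wave ξ y := by
  rw [wave, wave, wave, ← Complex.exp_add, inner_add_right]
  push_cast
  ring_nf

lemma wave_smul_left (t : ℝ) (ξ x : E) : wave (t • ξ) x = wave ξ (t • x) := by
  rw [wave, wave, real_inner_smul_left, real_inner_smul_right]

lemma wave_zero_left (x : E) : wave 0 x = 1 := by simp [wave]

lemma continuous_wave : Continuous fun p : E × E => wave p.1 p.2 := by
  unfold wave; fun_prop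

@[fun_prop]
lemma Continuous.wave {α : Type*} [TopologicalSpace α] {f g : α → E} (hf : Continuous f)
    (hg : Continuous g) : Continuous fun a => wave (f a) (g a) :=
  continuous_wave.comp (hf.prodMk hg)

lemma norm_wave_sub_one_le (ξ u : E) : ‖wave ξ u - 1‖ ≤ (2 + ‖ξ‖) * min 1 ‖u‖ := by
  rcases le_total 1 ‖u‖ with h | h
  · rw [min_eq_left h, mul_one]
    calc ‖wave ξ u - 1‖ ≤ ‖wave ξ u‖ + ‖(1 : ℂ)‖ := norm_sub_le _ _
      _ ≤ 2 + ‖ξ‖ := by rw [norm_wave, norm_one]; linarith [norm_nonneg ξ]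
  · rw [min_eq_right h]
    calc ‖wave ξ u - 1‖ ≤ ‖⟪ξ, u⟫‖ := Real.norm_exp_I_mul_ofReal_sub_one_le
      _ ≤ ‖ξ‖ * ‖u‖ := norm_inner_le_norm _ _
      _ ≤ (2 + ‖ξ‖) * ‖u‖ := by gcongr; linarith

/-- The measure `dv / v` on `(0,1)`. -/
def invMeasure : Measure ℝ :=
  (volume.restrict (Ioo (0 : ℝ) 1)).withDensity fun v => ENNReal.ofReal v⁻¹

instance : SigmaFinite invMeasure :=
  SigmaFinite.withDensity_ofReal (fun v : ℝ => v⁻¹)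

/-- A measure without atom at the origin that integrates `min 1 ‖u‖` is `s`-finite. -/
lemma sFinite_of_integrable_min {α : Type*} [NormedAddCommGroup α] [MeasurableSpace α]
    {m : Measure α} (hm0 : m {0} = 0)
    (hm : Integrable (fun u => min 1 ‖u‖) m) : SFinite m := by
  have hfin := hm.aefinStronglyMeasurable
  have h1 : SigmaFinite (m.restrict hfin.sigmaFiniteSet) := hfin.sigmaFinite_restrict
  have hne : ∀ᵐ u ∂m, u ≠ 0 := by
    rw [ae_iff]
    simpa using hm0
  have h2 : m.restrict hfin.sigmaFiniteSetᶜ = 0 := by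
    refine ae_eq_bot.1 (Filter.eventually_false_iff_eq_bot.1 ?_)
    filter_upwards [hfin.ae_eq_zero_compl, ae_restrict_of_ae hne] with u h3 h4
    have : 0 < min 1 ‖u‖ := lt_min one_pos (norm_pos_iff.2 h4)
    exact this.ne' h3
  have h3 := Measure.restrict_add_restrict_compl (μ := m) hfin.measurableSet
  rw [h2, add_zero] at h3
  rw [← h3]
  infer_instance

variable [MeasurableSpace E] [BorelSpace E] [FiniteDimensional ℝ E]

lemma eq_map_smul_prod_invMeasure {m ν : Measure E} [SFinite m]
    (h : ∀ g : E → ℝ≥0∞, Measurable g →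
      ∫⁻ u, g u ∂ν = ∫⁻ u, (∫⁻ v in Ioo (0 : ℝ) 1, g (v • u) * ENNReal.ofReal v⁻¹) ∂m) :
    ν = (m.prod invMeasure).map fun p => p.2 • p.1 := by
  refine Measure.ext_of_lintegral _ fun g hg => ?_
  have hgm : Measurable fun p : E × ℝ => g (p.2 • p.1) := hg.comp (by fun_prop)
  rw [h g hg, lintegral_map hg (by fun_prop), lintegral_prod _ hgm.aemeasurable]
  refine lintegral_congr fun u => ?_
  have hgu : Measurable fun v : ℝ => g (v • u) := hg.comp (by fun_prop)
  rw [invMeasure, lintegral_withDensity_eq_lintegral_mul _ (by fun_prop) hgu]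
  refine lintegral_congr fun v => ?_
  simp [mul_comm]

lemma integral_eq_of_eq_map_smul {m ν : Measure E} [SFinite m]
    (h : ν = (m.prod invMeasure).map fun p => p.2 • p.1) {F : E → ℂ} (hF : Integrable F ν) :
    IntegrableOn (fun v : ℝ => (v : ℂ)⁻¹ * ∫ u, F (v • u) ∂m) (Ioo 0 1) ∧
      ∫ u, F u ∂ν = ∫ v in Ioo (0 : ℝ) 1, (v : ℂ)⁻¹ * ∫ u, F (v • u) ∂m := by
  have hF' := hF
  rw [h, integrable_map_measure (by rw [← h]; exact hF.aestronglyMeasurable) (by fun_prop)] at hF'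
  have h1 := hF'.integral_prod_right
  simp only [Function.comp] at h1
  have hne : ∀ᵐ v ∂(volume.restrict (Ioo (0 : ℝ) 1)), ENNReal.ofReal v⁻¹ < ⊤ :=
    ae_of_all _ fun _ => ENNReal.ofReal_lt_top
  have hsm : ∀ᵐ v ∂(volume.restrict (Ioo (0 : ℝ) 1)),
      (ENNReal.ofReal v⁻¹).toReal • (∫ u, F (v • u) ∂m) = (v : ℂ)⁻¹ * ∫ u, F (v • u) ∂m := by
    refine (ae_restrict_mem measurableSet_Ioo).mono fun v hv => ?_
    rw [ENNReal.toReal_ofReal (inv_nonneg.2 hv.1.le), Complex.real_smul, Complex.ofReal_inv]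
  refine ⟨?_, ?_⟩
  · rw [invMeasure, integrable_withDensity_iff_integrable_smul' (by fun_prop) hne] at h1
    exact h1.congr hsm
  · rw [h, integral_map (by fun_prop) (by rw [← h]; exact hF.aestronglyMeasurable),
      integral_prod_symm (fun p : E × ℝ => F (p.2 • p.1)) hF', invMeasure,
      integral_withDensity_eq_integral_toReal_smul (by fun_prop) hne]
    exact integral_congr_ae hsm

/-- The integral `∫ (exp (i ⟨ξ, u⟩) - 1) m(du)`. -/
def jumpExp (m : Measure E) (ξ : E) : ℂ := ∫ u, (wave ξ u - 1) ∂m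

lemma integrable_wave_sub_one {m : Measure E} (hm : Integrable (fun u => min 1 ‖u‖) m) (ξ : E) :
    Integrable (fun u => wave ξ u - 1) m :=
  (hm.const_mul (2 + ‖ξ‖)).mono' (by fun_prop) (ae_of_all _ (norm_wave_sub_one_le ξ))

lemma jumpExp_zero (m : Measure E) : jumpExp m 0 = 0 := by simp [jumpExp, wave_zero_left]

lemma norm_jumpExp_le {m : Measure E} (hm : Integrable (fun u => min 1 ‖u‖) m) (ξ : E) :
    ‖jumpExp m ξ‖ ≤ (2 + ‖ξ‖) * ∫ u, min 1 ‖u‖ ∂m := by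
  rw [← integral_const_mul]
  exact norm_integral_le_of_norm_le (hm.const_mul _) (ae_of_all _ (norm_wave_sub_one_le ξ))

lemma continuous_jumpExp {m : Measure E} (hm : Integrable (fun u => min 1 ‖u‖) m) :
    Continuous (jumpExp m) := by
  refine continuous_iff_continuousAt.2 fun ξ => ?_
  refine continuousAt_of_dominated (bound := fun u => (2 + (‖ξ‖ + 1)) * min 1 ‖u‖)
    (Eventually.of_forall fun ζ => by fun_prop) ?_ (hm.const_mul _)
    (ae_of_all _ fun u => by fun_prop)
  have h : ∀ᶠ ζ in 𝓝 ξ, ‖ζ‖ < ‖ξ‖ + 1 :=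
    continuous_norm.continuousAt.eventually_lt continuousAt_const (by simp)
  filter_upwards [h] with ζ hζ
  refine ae_of_all _ fun u => (norm_wave_sub_one_le ζ u).trans ?_
  gcongr

/-- The exponent of an infinitely divisible law with drift `b` and Lévy measure `ν`. -/
def levyExponent (b : E) (ν : Measure E) (ξ : E) : ℂ :=
  Complex.I * ((⟪ξ, b⟫ : ℝ) : ℂ) + jumpExp ν ξ

/-- The radial logarithmic derivative of the characteristic function. -/
def radialRate (b : E) (m : Measure E) (ξ : E) (v : ℝ) : ℂ :=
  Complex.I * ((⟪ξ, b⟫ : ℝ) : ℂ) + (v : ℂ)⁻¹ * jumpExp m (v • ξ)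

lemma continuousOn_inv_mul_jumpExp {m : Measure E} (hm : Integrable (fun u => min 1 ‖u‖) m)
    (ξ : E) : ContinuousOn (fun v : ℝ => (v : ℂ)⁻¹ * jumpExp m (v • ξ)) (Ioi 0) := by
  have h := continuous_jumpExp hm
  refine ContinuousOn.mul (ContinuousOn.inv₀ (by fun_prop) fun v hv => ?_) (by fun_prop)
  exact Complex.ofReal_ne_zero.2 (ne_of_gt hv)

lemma jumpExp_smul_eq {m ν : Measure E} [SFinite m]
    (hν : Integrable (fun u => min 1 ‖u‖) ν)
    (h : ν = (m.prod invMeasure).map fun p => p.2 • p.1) (ξ : E) {t : ℝ} (ht : 0 < t) :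
    IntervalIntegrable (fun v : ℝ => (v : ℂ)⁻¹ * jumpExp m (v • ξ)) volume 0 t ∧
      jumpExp ν (t • ξ) = ∫ v in (0 : ℝ)..t, (v : ℂ)⁻¹ * jumpExp m (v • ξ) := by
  obtain ⟨h1, h2⟩ := integral_eq_of_eq_map_smul h (integrable_wave_sub_one hν (t • ξ))
  set G : ℝ → ℂ := fun v => (v : ℂ)⁻¹ * jumpExp m (v • ξ) with hG
  have h3 : (fun v : ℝ => (v : ℂ)⁻¹ * ∫ u, (wave (t • ξ) (v • u) - 1) ∂m)
      = fun v => t • G (t * v) := by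
    ext v
    have : (t : ℂ) ≠ 0 := Complex.ofReal_ne_zero.2 ht.ne'
    simp only [hG, jumpExp, Complex.real_smul, ← wave_smul_left, smul_smul]
    rw [mul_comm v t]
    push_cast
    rw [mul_inv, ← mul_assoc, mul_inv_cancel_left₀ this]
  rw [h3] at h1 h2
  have h4 : IntervalIntegrable (fun v => G (t * v)) volume 0 1 := by
    rw [intervalIntegrable_iff_integrableOn_Ioo_of_le zero_le_one]
    exact (integrable_smul_iff ht.ne' _).1 h1
  refine ⟨?_, ?_⟩
  · exact (IntervalIntegrable.comp_mul_left_iff ht.ne').1 (by simpa [ht.ne'] using h4)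
  · rw [jumpExp, h2, ← integral_Ioc_eq_integral_Ioo, ← intervalIntegral.integral_of_le zero_le_one,
      intervalIntegral.integral_smul, intervalIntegral.smul_integral_comp_mul_left]
    simp

lemma hasDerivAt_levyExponent {m ν : Measure E} [SFinite m]
    (hm : Integrable (fun u => min 1 ‖u‖) m) (hν : Integrable (fun u => min 1 ‖u‖) ν)
    (h : ν = (m.prod invMeasure).map fun p => p.2 • p.1) (b ξ : E) {t : ℝ} (ht : 0 < t) :
    HasDerivAt (fun t : ℝ => levyExponent b ν (t • ξ)) (radialRate b m ξ t) t := by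
  have hc := continuousOn_inv_mul_jumpExp hm ξ
  have h1 := intervalIntegral.integral_hasDerivAt_right (jumpExp_smul_eq hν h ξ ht).1
    (hc.stronglyMeasurableAtFilter isOpen_Ioi t ht) (hc.continuousAt (Ioi_mem_nhds ht))
  have h2 : HasDerivAt (fun t : ℝ => jumpExp ν (t • ξ)) ((t : ℂ)⁻¹ * jumpExp m (t • ξ)) t := by
    refine h1.congr_of_eventuallyEq ?_
    filter_upwards [Ioi_mem_nhds ht] with s hs using (jumpExp_smul_eq hν h ξ hs).2
  have h3 : HasDerivAt (fun t : ℝ => Complex.I * ((⟪t • ξ, b⟫ : ℝ) : ℂ))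
      (Complex.I * ((⟪ξ, b⟫ : ℝ) : ℂ)) t := by
    have : HasDerivAt (fun t : ℝ => ((t * ⟪ξ, b⟫ : ℝ) : ℂ)) ((1 * ⟪ξ, b⟫ : ℝ) : ℂ) t :=
      ((hasDerivAt_id t).mul_const _).ofReal_comp
    simpa [real_inner_smul_left] using this.const_mul Complex.I
  exact h3.add h2

lemma norm_radialRate_le {m : Measure E} (hm : Integrable (fun u => min 1 ‖u‖) m) (b ξ : E)
    {v : ℝ} (hv : 0 < v) :
    ‖radialRate b m ξ v‖ ≤ ‖ξ‖ * ‖b‖ + v⁻¹ * ((2 + v * ‖ξ‖) * ∫ u, min 1 ‖u‖ ∂m) := by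
  refine (norm_add_le _ _).trans (add_le_add ?_ ?_)
  · rw [norm_mul, Complex.norm_I, one_mul, Complex.norm_real]
    exact norm_inner_le_norm _ _
  · rw [norm_mul, norm_inv, Complex.norm_real, Real.norm_of_nonneg hv.le]
    have := norm_jumpExp_le hm (v • ξ)
    rw [norm_smul, Real.norm_of_nonneg hv.le] at this
    gcongr

section Generator

variable {F : Type*} [NormedAddCommGroup F] [NormedSpace ℝ F] {f : E → F} {C : ℝ}
  {b : E} {m μ : Measure E}

/-- The operator on the right-hand side of the Stein identity for `x ↦ f (v • x)`,
divided by `v`. -/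
def steinGen (b : E) (m : Measure E) (f : E → F) (v : ℝ) (x : E) : F :=
  fderiv ℝ f (v • x) b + v⁻¹ • ∫ u, (f (v • x + v • u) - f (v • x)) ∂m

lemma norm_sub_le_mul_min (hf : Differentiable ℝ f) (h0 : ∀ x, ‖f x‖ ≤ C)
    (h1 : ∀ x, ‖fderiv ℝ f x‖ ≤ C) {v : ℝ} (hv : v ∈ Ioc (0 : ℝ) 1) (x u : E) :
    ‖f (x + v • u) - f x‖ ≤ 2 * C * min 1 ‖u‖ := by
  have hC : 0 ≤ C := (norm_nonneg _).trans (h0 0)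
  rcases le_total 1 ‖u‖ with h | h
  · rw [min_eq_left h]
    linarith [norm_sub_le (f (x + v • u)) (f x), h0 (x + v • u), h0 x]
  · rw [min_eq_right h]
    have := convex_univ.norm_image_sub_le_of_norm_fderiv_le (fun y _ => hf y)
      (fun y _ => h1 y) (mem_univ x) (mem_univ (x + v • u))
    rw [add_sub_cancel_left, norm_smul, Real.norm_of_nonneg hv.1.le] at this
    nlinarith [mul_nonneg hC (norm_nonneg u), mul_nonneg (mul_nonneg hC (norm_nonneg u))
      (sub_nonneg.2 hv.2)]

lemma norm_steinGen_le (hm : Integrable (fun u => min 1 ‖u‖) m) (hf : Differentiable ℝ f)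
    (h0 : ∀ x, ‖f x‖ ≤ C) (h1 : ∀ x, ‖fderiv ℝ f x‖ ≤ C) {v : ℝ} (hv : v ∈ Ioc (0 : ℝ) 1)
    (x : E) :
    ‖steinGen b m f v x‖ ≤ C * ‖b‖ + v⁻¹ * (2 * C * ∫ u, min 1 ‖u‖ ∂m) := by
  refine (norm_add_le _ _).trans (add_le_add ?_ ?_)
  · exact (ContinuousLinearMap.le_opNorm _ _).trans (by gcongr; exact h1 _)
  · rw [norm_smul, norm_inv, Real.norm_of_nonneg hv.1.le, ← integral_const_mul]
    gcongr
    · exact inv_nonneg.2 hv.1.le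
    · exact norm_integral_le_of_norm_le (hm.const_mul _)
        (ae_of_all _ fun u => norm_sub_le_mul_min hf h0 h1 hv _ _)

lemma tendsto_steinGen {g : ℕ → E → F} (hm : Integrable (fun u => min 1 ‖u‖) m)
    (hg : ∀ n, Differentiable ℝ (g n)) (h0 : ∀ n x, ‖g n x‖ ≤ C)
    (h1 : ∀ n x, ‖fderiv ℝ (g n) x‖ ≤ C) (hgf : ∀ x, ∀ᶠ n in atTop, g n =ᶠ[𝓝 x] f)
    {v : ℝ} (hv : v ∈ Ioc (0 : ℝ) 1) (x : E) :
    Tendsto (fun n => steinGen b m (g n) v x) atTop (𝓝 (steinGen b m f v x)) := by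
  refine Tendsto.add ?_ (Tendsto.const_smul ?_ _)
  · refine tendsto_const_nhds.congr' ?_
    filter_upwards [hgf (v • x)] with n hn
    rw [hn.fderiv_eq]
  · refine tendsto_integral_of_dominated_convergence (fun u => 2 * C * min 1 ‖u‖)
      (fun n => ?_) (hm.const_mul _)
      (fun n => ae_of_all _ fun u => norm_sub_le_mul_min (hg n) (h0 n) (h1 n) hv _ _)
      (ae_of_all _ fun u => ?_)
    · have := (hg n).continuous
      exact Continuous.aestronglyMeasurable (by fun_prop)
    · refine tendsto_const_nhds.congr' ?_
      filter_upwards [hgf (v • x), hgf (v • x + v • u)] with n h2 h3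
      rw [h2.eq_of_nhds, h3.eq_of_nhds]

lemma stronglyMeasurable_steinGen [SFinite m] (hf : ContDiff ℝ 1 f) :
    StronglyMeasurable fun p : ℝ × E => steinGen b m f p.1 p.2 := by
  have h1 := hf.continuous
  have h2 := hf.continuous_fderiv one_ne_zero
  refine StronglyMeasurable.add (Continuous.stronglyMeasurable (by fun_prop))
    (StronglyMeasurable.smul (measurable_fst.inv.stronglyMeasurable) ?_)
  refine StronglyMeasurable.integral_prod_right' (f := fun q : (ℝ × E) × E =>
    f (q.1.1 • q.1.2 + q.1.1 • q.2) - f (q.1.1 • q.1.2)) ?_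
  exact Continuous.stronglyMeasurable (by fun_prop)

lemma integrable_steinGen [SFinite m] [IsFiniteMeasure μ]
    (hm : Integrable (fun u => min 1 ‖u‖) m) (hf : ContDiff ℝ 1 f)
    (h0 : ∀ x, ‖f x‖ ≤ C) (h1 : ∀ x, ‖fderiv ℝ f x‖ ≤ C) {v : ℝ} (hv : v ∈ Ioc (0 : ℝ) 1) :
    Integrable (steinGen b m f v) μ :=
  Integrable.of_bound
    ((stronglyMeasurable_steinGen hf).comp_measurable measurable_prodMk_left).aestronglyMeasurable
    _ (ae_of_all _ (norm_steinGen_le hm (hf.differentiable one_ne_zero) h0 h1 hv))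

lemma norm_integral_steinGen_le [IsProbabilityMeasure μ]
    (hm : Integrable (fun u => min 1 ‖u‖) m) (hf : Differentiable ℝ f)
    (h0 : ∀ x, ‖f x‖ ≤ C) (h1 : ∀ x, ‖fderiv ℝ f x‖ ≤ C) {s v : ℝ} (hs : 0 < s)
    (hv : v ∈ Ioc s 1) :
    ‖∫ x, steinGen b m f v x ∂μ‖ ≤ C * ‖b‖ + s⁻¹ * (2 * C * ∫ u, min 1 ‖u‖ ∂m) := by
  have hC : 0 ≤ C := (norm_nonneg _).trans (h0 0)
  have hM : 0 ≤ ∫ u, min 1 ‖u‖ ∂m := integral_nonneg fun u => by positivity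
  have hv' : v ∈ Ioc (0 : ℝ) 1 := ⟨hs.trans hv.1, hv.2⟩
  have := norm_integral_le_of_norm_le_const (μ := μ)
    (ae_of_all μ (norm_steinGen_le (b := b) hm hf h0 h1 hv'))
  rw [probReal_univ, mul_one] at this
  refine this.trans ?_
  gcongr
  exact hv.1.le

lemma intervalIntegrable_integral_steinGen [SFinite m] [IsProbabilityMeasure μ]
    (hm : Integrable (fun u => min 1 ‖u‖) m) (hf : ContDiff ℝ 1 f)
    (h0 : ∀ x, ‖f x‖ ≤ C) (h1 : ∀ x, ‖fderiv ℝ f x‖ ≤ C) {s : ℝ} (hs : s ∈ Ioc (0 : ℝ) 1) :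
    IntervalIntegrable (fun v => ∫ x, steinGen b m f v x ∂μ) volume s 1 := by
  rw [intervalIntegrable_iff_integrableOn_Ioc_of_le hs.2]
  refine Integrable.of_bound
    ((stronglyMeasurable_steinGen hf).integral_prod_right').aestronglyMeasurable
    (C * ‖b‖ + s⁻¹ * (2 * C * ∫ u, min 1 ‖u‖ ∂m)) ?_
  filter_upwards [ae_restrict_mem measurableSet_Ioc] with v hv
  exact norm_integral_steinGen_le hm (hf.differentiable one_ne_zero) h0 h1 hs.1 hv

/-- The integrated Stein identity is stable under bounded locally eventually constant limits. -/
lemma integral_sub_integral_eq_of_tendsto [SFinite m] [IsProbabilityMeasure μ] {g : ℕ → E → F}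
    (hm : Integrable (fun u => min 1 ‖u‖) m)
    (hg : ∀ n, ContDiff ℝ 1 (g n)) (h0 : ∀ n x, ‖g n x‖ ≤ C)
    (h1 : ∀ n x, ‖fderiv ℝ (g n) x‖ ≤ C) (hgf : ∀ x, ∀ᶠ n in atTop, g n =ᶠ[𝓝 x] f)
    {s : ℝ} (hs : s ∈ Ioc (0 : ℝ) 1)
    (h : ∀ n, ∫ x, g n x ∂μ - ∫ x, g n (s • x) ∂μ
      = ∫ v in s..1, ∫ x, steinGen b m (g n) v x ∂μ) :
    ∫ x, f x ∂μ - ∫ x, f (s • x) ∂μ = ∫ v in s..1, ∫ x, steinGen b m f v x ∂μ := by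
  have hd : ∀ n, Differentiable ℝ (g n) := fun n => (hg n).differentiable one_ne_zero
  have key : ∀ t : ℝ, Tendsto (fun n => ∫ x, g n (t • x) ∂μ) atTop (𝓝 (∫ x, f (t • x) ∂μ)) := by
    intro t
    refine tendsto_integral_of_dominated_convergence (fun _ => C) (fun n => ?_)
      (integrable_const _) (fun n => ae_of_all _ fun x => h0 n _) (ae_of_all _ fun x => ?_)
    · have := (hd n).continuous
      exact Continuous.aestronglyMeasurable (by fun_prop)
    · refine tendsto_const_nhds.congr' ?_
      filter_upwards [hgf (t • x)] with n hn using hn.eq_of_nhds.symm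
  have hL := (key 1).sub (key s)
  simp only [one_smul, h] at hL
  refine tendsto_nhds_unique hL ?_
  refine intervalIntegral.tendsto_integral_filter_of_dominated_convergence
    (fun _ => C * ‖b‖ + s⁻¹ * (2 * C * ∫ u, min 1 ‖u‖ ∂m))
    (Eventually.of_forall fun n =>
      ((stronglyMeasurable_steinGen (hg n)).integral_prod_right').aestronglyMeasurable)
    (Eventually.of_forall fun n => ae_of_all _ fun v hv => ?_) (by simp)
    (ae_of_all _ fun v hv => ?_)
  · rw [uIoc_of_le hs.2] at hv
    exact norm_integral_steinGen_le hm (hd n) (h0 n) (h1 n) hs.1 hv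
  · rw [uIoc_of_le hs.2] at hv
    have hv' : v ∈ Ioc (0 : ℝ) 1 := ⟨hs.1.trans hv.1, hv.2⟩
    exact tendsto_integral_of_dominated_convergence
      (fun _ => C * ‖b‖ + v⁻¹ * (2 * C * ∫ u, min 1 ‖u‖ ∂m))
      (fun n => (integrable_steinGen hm (hg n) (h0 n) (h1 n) hv').aestronglyMeasurable)
      (integrable_const _)
      (fun n => ae_of_all _ fun x => norm_steinGen_le hm (hd n) (h0 n) (h1 n) hv' x)
      (ae_of_all _ fun x => tendsto_steinGen hm hd h0 h1 hgf hv' x)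

end Generator

lemma SchwartzMap.exists_norm_le {F : Type*} [NormedAddCommGroup F] [NormedSpace ℝ F]
    (f : SchwartzMap E F) :
    ∃ C, (∀ x, ‖f x‖ ≤ C) ∧ (∀ x, ‖fderiv ℝ f x‖ ≤ C) ∧ ∀ x, ‖fderiv ℝ f x x‖ ≤ C := by
  obtain ⟨C₀, -, h0⟩ := f.decay 0 0
  obtain ⟨C₁, -, h1⟩ := f.decay 0 1
  obtain ⟨C₂, -, h2⟩ := f.decay 1 1
  simp only [pow_zero, one_mul, norm_iteratedFDeriv_zero, norm_iteratedFDeriv_one, pow_one]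
    at h0 h1 h2
  refine ⟨max C₀ (max C₁ C₂), fun x => (h0 x).trans (le_max_left _ _),
    fun x => (h1 x).trans ((le_max_left _ _).trans (le_max_right _ _)), fun x => ?_⟩
  refine (ContinuousLinearMap.le_opNorm _ _).trans ?_
  rw [mul_comm]
  exact (h2 x).trans ((le_max_right _ _).trans (le_max_right _ _))

lemma hasDerivAt_comp_smul {F : Type*} [NormedAddCommGroup F] [NormedSpace ℝ F] {f : E → F}
    (hf : Differentiable ℝ f) (x : E) (v : ℝ) :
    HasDerivAt (fun v : ℝ => f (v • x)) (fderiv ℝ f (v • x) x) v := by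
  have h : HasDerivAt (fun v : ℝ => v • x) x v := by
    simpa using (hasDerivAt_id v).smul_const x
  exact (hf (v • x)).hasFDerivAt.comp_hasDerivAt v h

lemma SchwartzMap.hasDerivAt_integral_comp_smul {F : Type*} [NormedAddCommGroup F]
    [NormedSpace ℝ F] (f : SchwartzMap E F) (μ : Measure E) [IsFiniteMeasure μ] {v : ℝ}
    (hv : 0 < v) :
    HasDerivAt (fun v : ℝ => ∫ x, f (v • x) ∂μ) (∫ x, fderiv ℝ f (v • x) x ∂μ) v := by
  obtain ⟨C, h0, -, h2⟩ := f.exists_norm_le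
  have hC : 0 ≤ C := (norm_nonneg _).trans (h0 0)
  have hc := f.continuous
  have hc' := (f.smooth 1).continuous_fderiv one_ne_zero
  refine (hasDerivAt_integral_of_dominated_loc_of_deriv_le (s := Ioi (v / 2))
    (F := fun (v : ℝ) x => f (v • x)) (F' := fun v x => fderiv ℝ f (v • x) x)
    (bound := fun _ => (v / 2)⁻¹ * C)
    (Ioi_mem_nhds (by linarith)) (Eventually.of_forall fun w => ?_) ?_ ?_ ?_
    (integrable_const _) ?_).2
  · exact Continuous.aestronglyMeasurable (by fun_prop)
  · exact Integrable.of_bound (Continuous.aestronglyMeasurable (by fun_prop)) C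
      (ae_of_all _ fun x => h0 _)
  · exact Continuous.aestronglyMeasurable (by fun_prop)
  · refine ae_of_all _ fun x w hw => ?_
    have hw : v / 2 < w := hw
    have hw0 : 0 < w := by linarith
    have h3 := h2 (w • x)
    rw [map_smul, norm_smul, Real.norm_of_nonneg hw0.le] at h3
    rw [inv_mul_eq_div, le_div_iff₀ (by linarith)]
    nlinarith [norm_nonneg (fderiv ℝ f (w • x) x)]
  · exact ae_of_all _ fun x w _ => hasDerivAt_comp_smul f.differentiable x w

/-- The Stein identity for all real Schwartz functions. -/
def SteinIdentity (b : E) (m μ : Measure E) : Prop :=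
  ∀ f : SchwartzMap E ℝ, ∫ x, fderiv ℝ f x x ∂μ = ∫ x, steinGen b m f 1 x ∂μ

lemma SteinIdentity.comp_smul {b : E} {m μ : Measure E} (h : SteinIdentity b m μ)
    (f : SchwartzMap E ℝ) {v : ℝ} (hv : 0 < v) :
    ∫ x, fderiv ℝ f (v • x) x ∂μ = ∫ x, steinGen b m f v x ∂μ := by
  let e : E ≃L[ℝ] E := ContinuousLinearEquiv.smulLeft (Units.mk0 v hv.ne')
  have hg : ∀ x, SchwartzMap.compCLMOfContinuousLinearEquiv ℝ e f x = f (v • x) := fun x => rfl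
  set g := SchwartzMap.compCLMOfContinuousLinearEquiv ℝ e f with hgdef
  have hg' : ∀ x y, fderiv ℝ g x y = v * fderiv ℝ f (v • x) y := by
    intro x y
    have h1 : HasFDerivAt (fun x : E => v • x) (v • ContinuousLinearMap.id ℝ E) x :=
      (hasFDerivAt_id x).const_smul v
    have h2 : HasFDerivAt g ((fderiv ℝ f (v • x)).comp (v • ContinuousLinearMap.id ℝ E)) x :=
      f.differentiableAt.hasFDerivAt.comp x h1
    rw [h2.fderiv]
    simp
  have h1 := h g
  have h2 : ∀ x, steinGen b m g 1 x = v * steinGen b m f v x := by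
    intro x
    simp only [steinGen, hg', hg, one_smul, inv_one, smul_add, smul_eq_mul, mul_add, one_mul]
    rw [mul_inv_cancel_left₀ hv.ne']
  simp only [hg', h2, integral_const_mul] at h1
  exact mul_left_cancel₀ hv.ne' h1

lemma SteinIdentity.integral_sub_integral_schwartz {b : E} {m μ : Measure E} [SFinite m]
    [IsProbabilityMeasure μ] (hm : Integrable (fun u => min 1 ‖u‖) m)
    (h : SteinIdentity b m μ) (f : SchwartzMap E ℝ) {s : ℝ} (hs : s ∈ Ioc (0 : ℝ) 1) :
    ∫ x, f x ∂μ - ∫ x, f (s • x) ∂μ = ∫ v in s..1, ∫ x, steinGen b m f v x ∂μ := by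
  obtain ⟨C, h0, h1, -⟩ := f.exists_norm_le
  rw [intervalIntegral.integral_eq_sub_of_hasDerivAt (f := fun v : ℝ => ∫ x, f (v • x) ∂μ)
    (fun v hv => ?_) (intervalIntegrable_integral_steinGen hm (f.smooth 1) h0 h1 hs)]
  · simp
  · rw [uIcc_of_le hs.2] at hv
    have hv0 : 0 < v := hs.1.trans_le hv.1
    rw [← h.comp_smul f hv0]
    exact f.hasDerivAt_integral_comp_smul μ hv0

/-- A bounded smooth function with bounded derivative is a locally eventually constant limit of
Schwartz functions that are bounded together with their derivatives. -/
lemma exists_seq_schwartzMap {f : E → ℝ} {C : ℝ} (hf : ContDiff ℝ (⊤ : ℕ∞) f)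
    (h0 : ∀ x, ‖f x‖ ≤ C) (h1 : ∀ x, ‖fderiv ℝ f x‖ ≤ C) :
    ∃ (g : ℕ → SchwartzMap E ℝ) (C' : ℝ), (∀ n x, ‖g n x‖ ≤ C') ∧
      (∀ n x, ‖fderiv ℝ (g n) x‖ ≤ C') ∧ ∀ x, ∀ᶠ n in atTop, ⇑(g n) =ᶠ[𝓝 x] f := by
  have hC : 0 ≤ C := (norm_nonneg _).trans (h0 0)
  let χ : ContDiffBump (0 : E) := ⟨1, 2, one_pos, one_lt_two⟩
  let χS : SchwartzMap E ℝ := χ.hasCompactSupport.toSchwartzMap χ.contDiff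
  obtain ⟨B, -, hB, -⟩ := χS.exists_norm_le
  have hB : ∀ x, ‖fderiv ℝ χ x‖ ≤ B := hB
  have hB0 : 0 ≤ B := (norm_nonneg _).trans (hB 0)
  let a : ℕ → ℝ := fun n => 1 / ((n : ℝ) + 1)
  have ha0 : ∀ n, 0 < a n := fun n => Nat.one_div_pos_of_nat
  have ha1 : ∀ n, a n ≤ 1 := fun n => by
    rw [div_le_one (by positivity)]
    linarith [(Nat.cast_nonneg n : (0 : ℝ) ≤ n)]
  have hcs : ∀ n, HasCompactSupport fun x => χ (a n • x) * f x := fun n =>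
    (χ.hasCompactSupport.comp_smul (ha0 n).ne').mul_right
  have hcd : ∀ n, ContDiff ℝ (⊤ : ℕ∞) fun x => χ (a n • x) * f x := fun n =>
    (χ.contDiff.comp (by fun_prop)).mul hf
  have hχ1 : ∀ x, ‖χ x‖ ≤ 1 := fun x => by
    rw [Real.norm_of_nonneg χ.nonneg]; exact χ.le_one
  refine ⟨fun n => (hcs n).toSchwartzMap (hcd n), C + B * C, fun n x => ?_, fun n x => ?_,
    fun x => ?_⟩
  · rw [HasCompactSupport.toSchwartzMap_toFun, norm_mul]
    have := mul_le_mul (hχ1 (a n • x)) (h0 x) (norm_nonneg _) zero_le_one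
    nlinarith [mul_nonneg hB0 hC]
  · have h2 : HasFDerivAt (fun x : E => a n • x) (a n • ContinuousLinearMap.id ℝ E) x :=
      (hasFDerivAt_id x).const_smul (a n)
    have h3 : HasFDerivAt (fun x => χ (a n • x))
        ((fderiv ℝ χ (a n • x)).comp (a n • ContinuousLinearMap.id ℝ E)) x :=
      ((χ.contDiff (n := 1)).differentiable one_ne_zero _).hasFDerivAt.comp x h2
    have h4 := h3.mul (hf.differentiable (by simp) x).hasFDerivAt
    have h5 : fderiv ℝ ((hcs n).toSchwartzMap (hcd n)) x = _ := h4.fderiv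
    rw [h5]
    refine (norm_add_le _ _).trans (add_le_add ?_ ?_)
    · rw [norm_smul]
      have := mul_le_mul (hχ1 (a n • x)) (h1 x) (norm_nonneg _) zero_le_one
      linarith
    · rw [norm_smul, mul_comm]
      have h6 : ‖(fderiv ℝ χ (a n • x)).comp (a n • ContinuousLinearMap.id ℝ E)‖ ≤ B := by
        rw [ContinuousLinearMap.comp_smul, ContinuousLinearMap.comp_id, norm_smul,
          Real.norm_of_nonneg (ha0 n).le]
        nlinarith [hB (a n • x), ha0 n, ha1 n, norm_nonneg (fderiv ℝ χ (a n • x))]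
      exact mul_le_mul h6 (h0 x) (norm_nonneg _) hB0
  · have h2 : Tendsto (fun n => ‖a n • x‖) atTop (𝓝 0) := by
      have := (tendsto_one_div_add_atTop_nhds_zero_nat (𝕜 := ℝ)).smul_const x
      simpa [a] using this.norm
    filter_upwards [h2.eventually_lt_const one_pos] with n hn
    have h3 : ContinuousAt (fun x : E => a n • x) x := by fun_prop
    have h4 := h3.eventually (χ.eventuallyEq_one_of_mem_ball (x := a n • x) (by simpa [χ] using hn))
    filter_upwards [h4] with y hy
    rw [HasCompactSupport.toSchwartzMap_toFun, hy]
    simp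

lemma SteinIdentity.integral_sub_integral {b : E} {m μ : Measure E} [SFinite m]
    [IsProbabilityMeasure μ] (hm : Integrable (fun u => min 1 ‖u‖) m)
    (h : SteinIdentity b m μ) {f : E → ℝ} {C : ℝ} (hf : ContDiff ℝ (⊤ : ℕ∞) f)
    (h0 : ∀ x, ‖f x‖ ≤ C) (h1 : ∀ x, ‖fderiv ℝ f x‖ ≤ C) {s : ℝ} (hs : s ∈ Ioc (0 : ℝ) 1) :
    ∫ x, f x ∂μ - ∫ x, f (s • x) ∂μ = ∫ v in s..1, ∫ x, steinGen b m f v x ∂μ := by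
  obtain ⟨g, C', hg0, hg1, hgf⟩ := exists_seq_schwartzMap hf h0 h1
  exact integral_sub_integral_eq_of_tendsto hm (fun n => (g n).smooth 1) hg0 hg1 hgf hs
    fun n => h.integral_sub_integral_schwartz hm (g n) hs

lemma hasFDerivAt_wave (ξ x : E) :
    HasFDerivAt (wave ξ)
      (wave ξ x • (Complex.I • (Complex.ofRealCLM.comp (innerSL ℝ ξ)))) x := by
  have h1 : HasFDerivAt (fun x : E => Complex.I * ((⟪ξ, x⟫ : ℝ) : ℂ))
      (Complex.I • (Complex.ofRealCLM.comp (innerSL ℝ ξ))) x :=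
    (Complex.ofRealCLM.comp (innerSL ℝ ξ)).hasFDerivAt.const_mul Complex.I
  exact h1.cexp

lemma fderiv_wave_apply (ξ x y : E) :
    fderiv ℝ (wave ξ) x y = wave ξ x * (Complex.I * ((⟪ξ, y⟫ : ℝ) : ℂ)) := by
  rw [(hasFDerivAt_wave ξ x).fderiv]
  simp

lemma norm_fderiv_wave_le (ξ x : E) : ‖fderiv ℝ (wave ξ) x‖ ≤ ‖ξ‖ := by
  refine ContinuousLinearMap.opNorm_le_bound _ (norm_nonneg _) fun y => ?_
  rw [fderiv_wave_apply, norm_mul, norm_mul, norm_wave, Complex.norm_I, one_mul, one_mul,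
    Complex.norm_real]
  exact norm_inner_le_norm _ _

lemma contDiff_wave (ξ : E) {n : WithTop ℕ∞} : ContDiff ℝ n (wave ξ) := by
  have h : ContDiff ℝ n fun x : E => ((⟪ξ, x⟫ : ℝ) : ℂ) :=
    ContinuousLinearMap.contDiff (𝕜 := ℝ) (Complex.ofRealCLM.comp (innerSL ℝ ξ))
  exact (contDiff_const.mul h).cexp

lemma steinGen_wave (b : E) (m : Measure E) (ξ : E) (v : ℝ) (x : E) :
    steinGen b m (wave ξ) v x = wave ξ (v • x) * radialRate b m ξ v := by
  have h : ∫ u, (wave ξ (v • x + v • u) - wave ξ (v • x)) ∂m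
      = wave ξ (v • x) * jumpExp m (v • ξ) := by
    rw [jumpExp, ← integral_const_mul]
    refine integral_congr_ae (ae_of_all _ fun u => ?_)
    simp only [wave_add, wave_smul_left]
    ring
  rw [steinGen, fderiv_wave_apply, radialRate, h, Complex.real_smul]
  push_cast
  ring

lemma steinGen_clm_comp {m : Measure E} (hm : Integrable (fun u => min 1 ‖u‖) m) (b : E)
    (ℓ : ℂ →L[ℝ] ℝ) {f : E → ℂ} {C : ℝ} (hf : ContDiff ℝ 1 f) (h0 : ∀ x, ‖f x‖ ≤ C)
    (h1 : ∀ x, ‖fderiv ℝ f x‖ ≤ C) {v : ℝ} (hv : v ∈ Ioc (0 : ℝ) 1) (x : E) :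
    steinGen b m (fun x => ℓ (f x)) v x = ℓ (steinGen b m f v x) := by
  have hd := hf.differentiable one_ne_zero
  have hc := hf.continuous
  have hi : Integrable (fun u => f (v • x + v • u) - f (v • x)) m :=
    (hm.const_mul (2 * C)).mono' (Continuous.aestronglyMeasurable (by fun_prop))
      (ae_of_all _ fun u => norm_sub_le_mul_min hd h0 h1 hv _ _)
  have h2 : fderiv ℝ (fun x => ℓ (f x)) (v • x) = ℓ.comp (fderiv ℝ f (v • x)) :=
    (ℓ.hasFDerivAt.comp (v • x) (hd (v • x)).hasFDerivAt).fderiv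
  simp only [steinGen, h2, map_add, map_smul, ContinuousLinearMap.comp_apply,
    ← ContinuousLinearMap.integral_comp_comm ℓ hi, map_sub]

lemma SteinIdentity.map_integral_sub_integral {b : E} {m μ : Measure E} [SFinite m]
    [IsProbabilityMeasure μ] (hm : Integrable (fun u => min 1 ‖u‖) m)
    (h : SteinIdentity b m μ) {f : E → ℂ} {C : ℝ} (hf : ContDiff ℝ (⊤ : ℕ∞) f)
    (h0 : ∀ x, ‖f x‖ ≤ C) (h1 : ∀ x, ‖fderiv ℝ f x‖ ≤ C) {s : ℝ} (hs : s ∈ Ioc (0 : ℝ) 1)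
    (ℓ : ℂ →L[ℝ] ℝ) :
    ℓ (∫ x, f x ∂μ - ∫ x, f (s • x) ∂μ) = ℓ (∫ v in s..1, ∫ x, steinGen b m f v x ∂μ) := by
  have hf1 : ContDiff ℝ 1 f := hf.of_le (by exact_mod_cast le_top)
  have hc := hf.continuous
  have hC : 0 ≤ C := (norm_nonneg _).trans (h0 0)
  have key := h.integral_sub_integral hm (f := fun x => ℓ (f x)) (C := ‖ℓ‖ * C)
    (ℓ.contDiff.comp hf) (fun x => (ℓ.le_opNorm _).trans (by gcongr; exact h0 x))
    (fun x => by
      have h2 : fderiv ℝ (fun x => ℓ (f x)) x = ℓ.comp (fderiv ℝ f x) :=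
        (ℓ.hasFDerivAt.comp x (hf1.differentiable one_ne_zero x).hasFDerivAt).fderiv
      rw [h2]
      exact (ContinuousLinearMap.opNorm_comp_le _ _).trans (by gcongr; exact h1 x)) hs
  have hi : ∀ t : ℝ, Integrable (fun x => f (t • x)) μ := fun t =>
    Integrable.of_bound (Continuous.aestronglyMeasurable (by fun_prop)) C
      (ae_of_all _ fun x => h0 _)
  have hi1 : Integrable f μ := by simpa using hi 1
  rw [ℓ.integral_comp_comm hi1, ℓ.integral_comp_comm (hi s)] at key
  rw [map_sub, key, intervalIntegral.integral_of_le hs.2, intervalIntegral.integral_of_le hs.2,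
    ← ℓ.integral_comp_comm
      (intervalIntegrable_integral_steinGen hm hf1 h0 h1 hs).1]
  refine setIntegral_congr_fun measurableSet_Ioc fun v hv => ?_
  have hv' : v ∈ Ioc (0 : ℝ) 1 := ⟨hs.1.trans hv.1, hv.2⟩
  rw [← ℓ.integral_comp_comm (integrable_steinGen hm hf1 h0 h1 hv')]
  exact integral_congr_ae (ae_of_all _ fun x => steinGen_clm_comp hm b ℓ hf1 h0 h1 hv' x)

lemma SteinIdentity.integral_wave_sub {b : E} {m μ : Measure E} [SFinite m]
    [IsProbabilityMeasure μ] (hm : Integrable (fun u => min 1 ‖u‖) m)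
    (h : SteinIdentity b m μ) (ξ : E) {s : ℝ} (hs : s ∈ Ioc (0 : ℝ) 1) :
    ∫ x, wave ξ x ∂μ - ∫ x, wave (s • ξ) x ∂μ
      = ∫ v in s..1, (∫ x, wave (v • ξ) x ∂μ) * radialRate b m ξ v := by
  have key := h.map_integral_sub_integral hm (f := wave ξ) (C := 1 + ‖ξ‖) (contDiff_wave ξ)
    (fun x => by rw [norm_wave]; linarith [norm_nonneg ξ])
    (fun x => by linarith [norm_fderiv_wave_le ξ x]) hs
  simp only [steinGen_wave, integral_mul_const, ← wave_smul_left] at key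
  exact Complex.ext (key Complex.reCLM) (key Complex.imCLM)

lemma continuous_integral_wave (μ : Measure E) [IsFiniteMeasure μ] :
    Continuous fun ξ : E => ∫ x, wave ξ x ∂μ :=
  continuous_of_dominated (bound := fun _ => 1) (fun ξ => by fun_prop)
    (fun ξ => ae_of_all _ fun x => (norm_wave ξ x).le) (integrable_const _)
    (ae_of_all _ fun x => by fun_prop)

lemma continuousOn_radialRate {m : Measure E} (hm : Integrable (fun u => min 1 ‖u‖) m)
    (b ξ : E) : ContinuousOn (radialRate b m ξ) (Ioi 0) :=
  continuousOn_const.add (continuousOn_inv_mul_jumpExp hm ξ)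

lemma SteinIdentity.integral_wave_eq {b : E} {m ν μ : Measure E} [SFinite m]
    [IsProbabilityMeasure μ] (hm : Integrable (fun u => min 1 ‖u‖) m)
    (hν : Integrable (fun u => min 1 ‖u‖) ν)
    (hmν : ν = (m.prod invMeasure).map fun p => p.2 • p.1)
    (h : SteinIdentity b m μ) (ξ : E) :
    ∫ x, wave ξ x ∂μ = Complex.exp (levyExponent b ν ξ) := by
  set φ : E → ℂ := fun ξ => ∫ x, wave ξ x ∂μ with hφ
  have hφc : Continuous φ := continuous_integral_wave μ
  have hG : ContinuousOn (fun v : ℝ => φ (v • ξ) * radialRate b m ξ v) (Ioi 0) :=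
    ContinuousOn.mul (by fun_prop) (continuousOn_radialRate hm b ξ)
  have hder : ∀ s ∈ Ioo (0 : ℝ) 1,
      HasDerivAt (fun s : ℝ => φ (s • ξ)) (φ (s • ξ) * radialRate b m ξ s) s := by
    intro s hs
    have hint : IntervalIntegrable (fun v : ℝ => φ (v • ξ) * radialRate b m ξ v) volume s 1 :=
      (hG.mono fun v hv => by
        rw [uIcc_of_le hs.2.le] at hv
        exact hs.1.trans_le hv.1).intervalIntegrable
    have h1 := intervalIntegral.integral_hasDerivAt_left hint
      (hG.stronglyMeasurableAtFilter isOpen_Ioi s hs.1) (hG.continuousAt (Ioi_mem_nhds hs.1))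
    have h2 := h1.const_sub (φ ξ)
    rw [neg_neg] at h2
    refine h2.congr_of_eventuallyEq ?_
    filter_upwards [Ioo_mem_nhds hs.1 hs.2] with t ht
    rw [← h.integral_wave_sub hm ξ ⟨ht.1, ht.2.le⟩]
    simp [hφ]
  set q : ℝ → ℂ := fun s => φ (s • ξ) * Complex.exp (-levyExponent b ν (s • ξ)) with hq
  have hlc : Continuous (levyExponent b ν) := by
    have := continuous_jumpExp hν
    unfold levyExponent
    fun_prop
  have hqc : Continuous q := by fun_prop
  have hqd : ∀ s ∈ Ioo (0 : ℝ) 1, HasDerivAt q 0 s := by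
    intro s hs
    have h1 := (hder s hs).mul (hasDerivAt_levyExponent hm hν hmν b ξ hs.1).neg.cexp
    refine h1.congr_deriv ?_
    simp only [Pi.neg_apply]
    ring
  have hq01 : q 1 = q 0 := by
    by_contra hne
    obtain ⟨c, hc, hc'⟩ := exists_hasDerivAt_eq_slope (fun s => ‖q s - q 0‖ ^ 2)
      (fun _ => 0) one_pos (by fun_prop) (fun s hs => by
        have := ((hqd s hs).sub_const (q 0)).norm_sq
        simpa using this)
    simp only [sub_self, norm_zero, sub_zero, div_one, ne_eq, OfNat.ofNat_ne_zero,
      not_false_eq_true, zero_pow] at hc'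
    exact hne (sub_eq_zero.1 (norm_eq_zero.1 (pow_eq_zero_iff two_ne_zero |>.1 hc'.symm)))
  have h1 : φ ξ * Complex.exp (-levyExponent b ν ξ) = 1 := by
    have : q 0 = 1 := by simp [hq, hφ, levyExponent, jumpExp_zero, wave_zero_left]
    simpa [hq] using hq01.trans this
  rw [Complex.exp_neg] at h1
  exact (mul_inv_eq_one₀ (Complex.exp_ne_zero _)).1 h1

section Synthesis

variable {ρ m μ : Measure E} {g f : E → ℂ}

lemma integrable_const_add_norm_mul (hg : Integrable g ρ)
    (hg1 : Integrable (fun ξ => ‖ξ‖ * ‖g ξ‖) ρ) (a c : ℝ) :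
    Integrable (fun ξ => (a + c * ‖ξ‖) * ‖g ξ‖) ρ := by
  have h := (hg.norm.const_mul a).add (hg1.const_mul c)
  refine h.congr (ae_of_all _ fun ξ => ?_)
  simp only [Pi.add_apply]
  ring

lemma integrable_mul_wave (hg : Integrable g ρ) (x : E) :
    Integrable (fun ξ => g ξ * wave ξ x) ρ :=
  hg.norm.mono' (hg.aestronglyMeasurable.mul (by fun_prop))
    (ae_of_all _ fun ξ => by rw [norm_mul, norm_wave, mul_one])

lemma fderiv_integral_mul_wave (hg : Integrable g ρ)
    (hg1 : Integrable (fun ξ => ‖ξ‖ * ‖g ξ‖) ρ) (x y : E) :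
    fderiv ℝ (fun x => ∫ ξ, g ξ * wave ξ x ∂ρ) x y
      = ∫ ξ, g ξ * (wave ξ x * (Complex.I * ((⟪ξ, y⟫ : ℝ) : ℂ))) ∂ρ := by
  have hmeas : AEStronglyMeasurable (fun ξ => g ξ • fderiv ℝ (wave ξ) x) ρ := by
    refine hg.aestronglyMeasurable.smul (Continuous.aestronglyMeasurable ?_)
    simp only [(hasFDerivAt_wave _ x).fderiv]
    have h : Continuous fun ξ : E => (Complex.I • Complex.ofRealCLM) ∘SL innerSL ℝ ξ :=
      continuous_const.clm_comp (innerSL ℝ).continuous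
    exact (Continuous.wave continuous_id continuous_const).smul h
  have hbound : ∀ z ξ, ‖g ξ • fderiv ℝ (wave ξ) z‖ ≤ ‖ξ‖ * ‖g ξ‖ := fun z ξ => by
    rw [norm_smul, mul_comm]
    exact mul_le_mul_of_nonneg_right (norm_fderiv_wave_le ξ z) (norm_nonneg _)
  have h := hasFDerivAt_integral_of_dominated_of_fderiv_le (s := univ) (x₀ := x)
    (F := fun x ξ => g ξ * wave ξ x) (F' := fun x ξ => g ξ • fderiv ℝ (wave ξ) x)
    univ_mem (Eventually.of_forall fun z => (integrable_mul_wave hg z).aestronglyMeasurable)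
    (integrable_mul_wave hg x) hmeas
    (ae_of_all _ fun ξ z _ => hbound z ξ) hg1
    (ae_of_all _ fun ξ z _ => by
      rw [(hasFDerivAt_wave ξ z).fderiv]
      exact (hasFDerivAt_wave ξ z).const_mul (g ξ))
  rw [h.fderiv, ContinuousLinearMap.integral_apply (hg1.mono' hmeas (ae_of_all _ (hbound x)))]
  simp [fderiv_wave_apply]

lemma steinGen_integral_mul_wave [SFinite ρ] [SFinite m]
    (hm : Integrable (fun u => min 1 ‖u‖) m) (hg : Integrable g ρ)
    (hg1 : Integrable (fun ξ => ‖ξ‖ * ‖g ξ‖) ρ) (b x : E) :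
    steinGen b m (fun x => ∫ ξ, g ξ * wave ξ x ∂ρ) 1 x
      = ∫ ξ, g ξ * (wave ξ x * radialRate b m ξ 1) ∂ρ := by
  have hW := integrable_const_add_norm_mul hg hg1 2 1
  have hprod : Integrable (Function.uncurry fun u ξ => g ξ * (wave ξ x * (wave ξ u - 1)))
      (m.prod ρ) := by
    refine (hm.mul_prod hW).mono' ?_ (ae_of_all _ fun p => ?_)
    · exact hg.aestronglyMeasurable.comp_snd.mul
        (Continuous.aestronglyMeasurable (by fun_prop))
    · have := norm_wave_sub_one_le p.2 p.1
      rw [Function.uncurry, norm_mul, norm_mul, norm_wave, one_mul]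
      nlinarith [norm_nonneg (g p.2)]
  have h1 : ∫ u, ((∫ ξ, g ξ * wave ξ (x + u) ∂ρ) - ∫ ξ, g ξ * wave ξ x ∂ρ) ∂m
      = ∫ ξ, g ξ * (wave ξ x * jumpExp m ξ) ∂ρ := by
    calc ∫ u, ((∫ ξ, g ξ * wave ξ (x + u) ∂ρ) - ∫ ξ, g ξ * wave ξ x ∂ρ) ∂m
        = ∫ u, ∫ ξ, g ξ * (wave ξ x * (wave ξ u - 1)) ∂ρ ∂m := by
          refine integral_congr_ae (ae_of_all _ fun u => ?_)
          simp only
          rw [← integral_sub (integrable_mul_wave hg _) (integrable_mul_wave hg _)]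
          refine integral_congr_ae (ae_of_all _ fun ξ => ?_)
          simp only [wave_add]
          ring
      _ = ∫ ξ, ∫ u, g ξ * (wave ξ x * (wave ξ u - 1)) ∂m ∂ρ := integral_integral_swap hprod
      _ = _ := by simp only [integral_const_mul, jumpExp]
  have hi1 : Integrable (fun ξ => g ξ * (wave ξ x * (Complex.I * ((⟪ξ, b⟫ : ℝ) : ℂ)))) ρ := by
    refine (hg1.const_mul ‖b‖).mono'
      (hg.aestronglyMeasurable.mul (Continuous.aestronglyMeasurable (by fun_prop)))
      (ae_of_all _ fun ξ => ?_)
    rw [norm_mul, norm_mul, norm_wave, norm_mul, Complex.norm_I, Complex.norm_real]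
    nlinarith [norm_inner_le_norm (𝕜 := ℝ) ξ b, norm_nonneg (g ξ)]
  have hi2 : Integrable (fun ξ => g ξ * (wave ξ x * jumpExp m ξ)) ρ := by
    refine (hW.mul_const (∫ u, min 1 ‖u‖ ∂m)).mono' ?_ (ae_of_all _ fun ξ => ?_)
    · have := continuous_jumpExp hm
      exact hg.aestronglyMeasurable.mul (Continuous.aestronglyMeasurable (by fun_prop))
    · rw [norm_mul, norm_mul, norm_wave, one_mul]
      nlinarith [norm_jumpExp_le hm ξ, norm_nonneg (g ξ)]
  simp only [steinGen, one_smul, inv_one]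
  rw [fderiv_integral_mul_wave hg hg1, h1, ← integral_add hi1 hi2]
  refine integral_congr_ae (ae_of_all _ fun ξ => ?_)
  simp only [radialRate, one_smul, Complex.ofReal_one, inv_one]
  ring

lemma integral_integral_mul_wave [SFinite ρ] [IsProbabilityMeasure μ] {w : E → ℂ}
    (hw : Continuous w) (hgw : Integrable (fun ξ => g ξ * w ξ) ρ)
    (hg : Integrable g ρ) (t : ℝ) :
    ∫ x, ∫ ξ, g ξ * (wave ξ (t • x) * w ξ) ∂ρ ∂μ
      = ∫ ξ, g ξ * ((∫ x, wave (t • ξ) x ∂μ) * w ξ) ∂ρ := by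
  have hprod : Integrable (Function.uncurry fun x ξ => g ξ * (wave ξ (t • x) * w ξ))
      (μ.prod ρ) := by
    refine ((integrable_const (1 : ℝ)).mul_prod hgw.norm).mono' ?_ (ae_of_all _ fun p => ?_)
    · exact hg.aestronglyMeasurable.comp_snd.mul
        (Continuous.aestronglyMeasurable (by fun_prop))
    · rw [Function.uncurry, norm_mul, norm_mul, norm_mul, norm_wave, one_mul, one_mul]
  rw [integral_integral_swap hprod]
  simp only [integral_const_mul, integral_mul_const, wave_smul_left]

lemma hasDerivAt_integral_mul_exp [SFinite m] {ν : Measure E}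
    (hm : Integrable (fun u => min 1 ‖u‖) m) (hν : Integrable (fun u => min 1 ‖u‖) ν)
    (hmν : ν = (m.prod invMeasure).map fun p => p.2 • p.1) {b : E}
    (hexp : ∀ ξ, ‖Complex.exp (levyExponent b ν ξ)‖ ≤ 1)
    (hg : Integrable g ρ) (hg1 : Integrable (fun ξ => ‖ξ‖ * ‖g ξ‖) ρ) :
    HasDerivAt (fun t : ℝ => ∫ ξ, g ξ * Complex.exp (levyExponent b ν (t • ξ)) ∂ρ)
      (∫ ξ, g ξ * (Complex.exp (levyExponent b ν ξ) * radialRate b m ξ 1) ∂ρ) 1 := by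
  set M := ∫ u, min 1 ‖u‖ ∂m with hM
  have hM0 : 0 ≤ M := integral_nonneg fun u => by positivity
  have hlc : Continuous (levyExponent b ν) := by
    have := continuous_jumpExp hν
    unfold levyExponent
    fun_prop
  have hjc := continuous_jumpExp hm
  have h := (hasDerivAt_integral_of_dominated_loc_of_deriv_le (𝕜 := ℝ) (x₀ := 1)
    (s := Ioi (1 / 2)) (μ := ρ)
    (F := fun (t : ℝ) ξ => g ξ * Complex.exp (levyExponent b ν (t • ξ)))
    (F' := fun t ξ => g ξ * (Complex.exp (levyExponent b ν (t • ξ)) * radialRate b m ξ t))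
    (bound := fun ξ => (4 * M + (‖b‖ + M) * ‖ξ‖) * ‖g ξ‖)
    (Ioi_mem_nhds (by norm_num))
    (Eventually.of_forall fun t => hg.aestronglyMeasurable.mul
      (Continuous.aestronglyMeasurable (by fun_prop)))
    (hg.norm.mono' (hg.aestronglyMeasurable.mul
      (Continuous.aestronglyMeasurable (by fun_prop)))
      (ae_of_all _ fun ξ => by
        rw [norm_mul]
        exact mul_le_of_le_one_right (norm_nonneg _) (hexp _)))
    (hg.aestronglyMeasurable.mul
      (Continuous.aestronglyMeasurable (by unfold radialRate; fun_prop)))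
    (ae_of_all _ fun ξ t ht => ?_) (integrable_const_add_norm_mul hg hg1 _ _)
    (ae_of_all _ fun ξ t ht => ?_)).2
  · simpa using h
  · have ht0 : (0 : ℝ) < t := lt_trans (by norm_num) ht
    have h1 := norm_radialRate_le hm b ξ ht0
    have h2 : t⁻¹ ≤ 2 := by
      rw [inv_le_comm₀ ht0 two_pos]
      have : (1 / 2 : ℝ) < t := ht
      linarith
    have h3 : t⁻¹ * ((2 + t * ‖ξ‖) * M) = t⁻¹ * (2 * M) + ‖ξ‖ * M := by
      field_simp
    have h4 : ‖radialRate b m ξ t‖ ≤ 4 * M + (‖b‖ + M) * ‖ξ‖ := by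
      rw [h3] at h1
      nlinarith
    rw [norm_mul, norm_mul, mul_comm]
    refine mul_le_mul_of_nonneg_right ?_ (norm_nonneg _)
    exact (mul_le_of_le_one_left (norm_nonneg _) (hexp _)).trans h4
  · have ht0 : (0 : ℝ) < t := lt_trans (by norm_num) ht
    exact (hasDerivAt_levyExponent hm hν hmν b ξ ht0).cexp.const_mul (g ξ)

end Synthesis

lemma SchwartzMap.exists_eq_integral_mul_wave (f : SchwartzMap E ℂ) :
    ∃ (ρ : Measure E) (g : E → ℂ), SFinite ρ ∧ Integrable g ρ ∧
      Integrable (fun ξ => ‖ξ‖ * ‖g ξ‖) ρ ∧ ⇑f = fun x => ∫ ξ, g ξ * wave ξ x ∂ρ := by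
  open FourierTransform in
  let c : ℝ := 2 * Real.pi
  have hc : c ≠ 0 := Real.two_pi_pos.ne'
  let e : E ≃ₜ E := Homeomorph.smulOfNeZero c hc
  have he : MeasurableEmbedding e := e.measurableEmbedding
  set G : SchwartzMap E ℂ := 𝓕 f with hG
  refine ⟨volume.map e, fun ξ => G (c⁻¹ • ξ), inferInstance, ?_, ?_, ?_⟩
  · rw [he.integrable_map_iff]
    refine G.integrable.congr (ae_of_all _ fun ξ => ?_)
    simp [e, hc]
  · rw [he.integrable_map_iff]
    have h := (G.integrable_pow_mul volume 1).const_mul |c|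
    refine h.congr (ae_of_all _ fun ξ => ?_)
    simp [e, hc, norm_smul, mul_assoc]
  · funext x
    have h1 : f = 𝓕⁻ G := by simp [hG]
    rw [he.integral_map]
    conv_lhs => rw [h1, SchwartzMap.fourierInv_coe, Real.fourierInv_eq']
    refine integral_congr_ae (ae_of_all _ fun ξ => ?_)
    simp only [e, Homeomorph.smulOfNeZero_apply, inv_smul_smul₀ hc, smul_eq_mul, wave, c,
      real_inner_smul_left]
    rw [mul_comm, mul_comm Complex.I]

lemma steinIdentity_of_integral_wave_eq {b : E} {m ν μ : Measure E} [SFinite m]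
    [IsProbabilityMeasure μ] (hm : Integrable (fun u => min 1 ‖u‖) m)
    (hν : Integrable (fun u => min 1 ‖u‖) ν)
    (hmν : ν = (m.prod invMeasure).map fun p => p.2 • p.1)
    (h : ∀ ξ, ∫ x, wave ξ x ∂μ = Complex.exp (levyExponent b ν ξ)) :
    SteinIdentity b m μ := by
  have hexp : ∀ ξ, ‖Complex.exp (levyExponent b ν ξ)‖ ≤ 1 := fun ξ => by
    rw [← h]
    simpa using norm_integral_le_of_norm_le_const (μ := μ)
      (ae_of_all μ fun x => (norm_wave ξ x).le)
  have key : ∀ f : SchwartzMap E ℂ,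
      ∫ x, fderiv ℝ f x x ∂μ = ∫ x, steinGen b m f 1 x ∂μ := by
    intro f
    obtain ⟨ρ, g, hρ, hg, hg1, hf⟩ := f.exists_eq_integral_mul_wave
    have hjc := continuous_jumpExp hm
    have hrc : Continuous fun ξ => radialRate b m ξ 1 := by unfold radialRate; fun_prop
    set M := ∫ u, min 1 ‖u‖ ∂m with hM
    have hgr : Integrable (fun ξ => g ξ * radialRate b m ξ 1) ρ := by
      refine (integrable_const_add_norm_mul hg hg1 (2 * M) (‖b‖ + M)).mono'
        (hg.aestronglyMeasurable.mul hrc.aestronglyMeasurable) (ae_of_all _ fun ξ => ?_)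
      have := norm_radialRate_le hm b ξ one_pos
      rw [norm_mul, mul_comm]
      refine mul_le_mul_of_nonneg_right (this.trans (le_of_eq ?_)) (norm_nonneg _)
      rw [inv_one]
      ring
    have h1 := f.hasDerivAt_integral_comp_smul μ one_pos
    simp only [one_smul] at h1
    have h2 := hasDerivAt_integral_mul_exp hm hν hmν hexp hg hg1
    have h3 : (fun t : ℝ => ∫ x, f (t • x) ∂μ)
        = fun t : ℝ => ∫ ξ, g ξ * Complex.exp (levyExponent b ν (t • ξ)) ∂ρ := by
      funext t
      have := integral_integral_mul_wave (μ := μ) (w := fun _ => 1) continuous_const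
        (by simpa using hg) hg t
      simp only [mul_one, h] at this
      rw [← this, hf]
    rw [h3] at h1
    rw [h1.unique h2]
    have h4 := integral_integral_mul_wave (μ := μ) hrc hgr hg 1
    simp only [one_smul, h] at h4
    rw [← h4, hf]
    exact integral_congr_ae
      (ae_of_all _ fun x => (steinGen_integral_mul_wave hm hg hg1 b x).symm)
  intro f
  let F : SchwartzMap E ℂ := f.postcompCLM Complex.ofRealCLM
  have hF : ∀ x, F x = f x := fun x => rfl
  obtain ⟨C, h0, h1, h2⟩ := F.exists_norm_le
  have hf : ⇑f = fun x => Complex.reCLM (F x) := by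
    funext x
    simp [hF]
  have hd : ∀ x, fderiv ℝ f x x = Complex.reCLM (fderiv ℝ F x x) := fun x => by
    have h3 : fderiv ℝ (fun x => Complex.reCLM (F x)) x
        = Complex.reCLM.comp (fderiv ℝ F x) :=
      (Complex.reCLM.hasFDerivAt.comp x (F.differentiable x).hasFDerivAt).fderiv
    rw [hf, h3, ContinuousLinearMap.comp_apply]
  have hv : (1 : ℝ) ∈ Ioc (0 : ℝ) 1 := ⟨one_pos, le_rfl⟩
  have hs : ∀ x, steinGen b m f 1 x = Complex.reCLM (steinGen b m F 1 x) := fun x => by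
    rw [hf]
    exact steinGen_clm_comp hm b Complex.reCLM (F.smooth 1) h0 h1 hv x
  have hc' := (F.smooth 1).continuous_fderiv one_ne_zero
  simp only [hd, hs]
  rw [Complex.reCLM.integral_comp_comm (integrable_steinGen hm (F.smooth 1) h0 h1 hv),
    Complex.reCLM.integral_comp_comm
      (Integrable.of_bound (Continuous.aestronglyMeasurable (by fun_prop)) C (ae_of_all _ h2)),
    key F]

lemma integrable_min_of_lintegral_lt_top {m : Measure E}
    (h : ∫⁻ u, ENNReal.ofReal (min 1 ‖u‖) ∂m < ⊤) : Integrable (fun u => min 1 ‖u‖) m := by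
  refine ⟨Continuous.aestronglyMeasurable (by fun_prop), ?_⟩
  rwa [hasFiniteIntegral_iff_ofReal (ae_of_all _ fun u => by positivity)]

lemma lintegral_min_lt_top {ν : Measure E}
    (h : ∫⁻ u, ENNReal.ofReal (min 1 (‖u‖ ^ 2)) ∂ν < ⊤)
    (h1 : ∫⁻ u in {u : E | ‖u‖ ≤ 1}, ENNReal.ofReal ‖u‖ ∂ν < ⊤) :
    ∫⁻ u, ENNReal.ofReal (min 1 ‖u‖) ∂ν < ⊤ := by
  have hs : MeasurableSet {u : E | ‖u‖ ≤ 1} :=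
    (isClosed_le continuous_norm continuous_const).measurableSet
  rw [← lintegral_add_compl _ hs]
  refine ENNReal.add_lt_top.2 ⟨?_, ?_⟩
  · refine lt_of_le_of_lt (lintegral_mono fun u => ?_) h1
    exact ENNReal.ofReal_le_ofReal (min_le_right _ _)
  · refine lt_of_le_of_lt ?_ h
    refine (setLIntegral_mono' hs.compl fun u hu => ?_).trans (setLIntegral_le_lintegral _ _)
    have hu : 1 < ‖u‖ := not_le.1 hu
    refine ENNReal.ofReal_le_ofReal ((min_le_left _ _).trans (le_min le_rfl ?_))
    nlinarith

lemma integrableOn_id_of_integrable_min {ν : Measure E}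
    (hν : Integrable (fun u => min 1 ‖u‖) ν) :
    IntegrableOn (fun u : E => u) {u | ‖u‖ ≤ 1} ν := by
  have hs : MeasurableSet {u : E | ‖u‖ ≤ 1} :=
    (isClosed_le continuous_norm continuous_const).measurableSet
  refine hν.integrableOn.mono' (Continuous.aestronglyMeasurable (by fun_prop)) ?_
  filter_upwards [ae_restrict_mem hs] with u hu
  exact le_min hu le_rfl

lemma integral_wave_sub_one_sub_truncation {ν : Measure E}
    (hν : Integrable (fun u => min 1 ‖u‖) ν) (b ξ : E) :
    Complex.I * ((⟪b, ξ⟫ : ℝ) : ℂ)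
        + ∫ u, (wave ξ u - 1 - (if ‖u‖ ≤ 1 then Complex.I * ((⟪ξ, u⟫ : ℝ) : ℂ) else 0)) ∂ν
      = levyExponent (b - ∫ u in {u : E | ‖u‖ ≤ 1}, u ∂ν) ν ξ := by
  have hs : MeasurableSet {u : E | ‖u‖ ≤ 1} :=
    (isClosed_le continuous_norm continuous_const).measurableSet
  have hid := integrableOn_id_of_integrable_min hν
  have h1 : (fun u : E => if ‖u‖ ≤ 1 then Complex.I * ((⟪ξ, u⟫ : ℝ) : ℂ) else 0)
      = {u : E | ‖u‖ ≤ 1}.indicator fun u => Complex.I * ((⟪ξ, u⟫ : ℝ) : ℂ) := by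
    funext u
    simp [indicator_apply]
  have h2 : IntegrableOn (fun u => Complex.I * ((⟪ξ, u⟫ : ℝ) : ℂ)) {u : E | ‖u‖ ≤ 1} ν :=
    (hid.const_inner ξ).ofReal.const_mul Complex.I
  have h3 : Integrable
      (fun u : E => if ‖u‖ ≤ 1 then Complex.I * ((⟪ξ, u⟫ : ℝ) : ℂ) else 0) ν := by
    rw [h1]
    exact h2.integrable_indicator hs
  rw [integral_sub (integrable_wave_sub_one hν ξ) h3, h1, integral_indicator hs,
    integral_const_mul, integral_complex_ofReal, integral_inner hid, levyExponent, jumpExp,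
    inner_sub_right, real_inner_comm]
  push_cast
  ring

lemma steinIdentity_iff [CompleteSpace E] {b : E} {m μ : Measure E} [SFinite m]
    [IsProbabilityMeasure μ] (hm : Integrable (fun u => min 1 ‖u‖) m) :
    SteinIdentity b m μ ↔ ∀ f : SchwartzMap E ℝ,
      ∫ x, ⟪x, gradient (⇑f) x⟫ ∂μ
        = ⟪b, ∫ x, gradient (⇑f) x ∂μ⟫ + ∫ x, ∫ u, (f (x + u) - f x) ∂m ∂μ := by
  refine forall_congr' fun f => ?_
  obtain ⟨C, h0, h1, -⟩ := f.exists_norm_le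
  have hc' := (f.smooth 1).continuous_fderiv one_ne_zero
  have hi := integrable_steinGen (b := b) (μ := μ) hm (f.smooth 1) h0 h1 ⟨one_pos, le_rfl⟩
  have hb : Integrable (fun x => fderiv ℝ f x b) μ :=
    Integrable.of_bound (Continuous.aestronglyMeasurable (by fun_prop)) (C * ‖b‖)
      (ae_of_all _ fun x => (ContinuousLinearMap.le_opNorm _ _).trans (by gcongr; exact h1 x))
  have hj : Integrable (fun x => ∫ u, (f (x + u) - f x) ∂m) μ := by
    refine (hi.sub hb).congr (ae_of_all _ fun x => ?_)
    simp [steinGen]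
  have hgrad : Integrable (gradient ⇑f) μ := by
    refine Integrable.of_bound (Continuous.aestronglyMeasurable ?_) C (ae_of_all _ fun x => ?_)
    · exact (InnerProductSpace.toDual ℝ E).symm.continuous.comp hc'
    · rw [gradient, LinearIsometryEquiv.norm_map]
      exact h1 x
  have hs : ∀ x, steinGen b m f 1 x = fderiv ℝ f x b + ∫ u, (f (x + u) - f x) ∂m := fun x => by
    simp [steinGen]
  have hin : ∀ x y, ⟪y, gradient (⇑f) x⟫ = fderiv ℝ f x y := fun x y => by
    rw [real_inner_comm, inner_gradient_left]
  rw [← integral_inner hgrad]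
  simp only [hin, hs]
  rw [integral_add hb hj]

section Polar

variable {σ : Measure E} {τ : E → Measure ℝ}

lemma measure_singleton_zero_of_polar {m : Measure E} (hσ : ∀ᵐ x ∂σ, ‖x‖ = 1)
    (hτ : ∀ x, τ x (Iic 0) = 0)
    (hm : ∀ g : E → ℝ≥0∞, Measurable g → ∫⁻ u, g u ∂m = ∫⁻ x, (∫⁻ r, g (r • x) ∂(τ x)) ∂σ) :
    m {0} = 0 := by
  have h := hm (({0} : Set E).indicator 1) (measurable_one.indicator (measurableSet_singleton 0))
  rw [lintegral_indicator_one (measurableSet_singleton 0)] at h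
  rw [h, lintegral_eq_zero_of_ae_eq_zero]
  filter_upwards [hσ] with x hx
  have hx0 : x ≠ 0 := by
    rintro rfl
    simp at hx
  refine lintegral_eq_zero_of_ae_eq_zero ?_
  have h1 : ∀ᵐ r ∂(τ x), r ∉ Iic (0 : ℝ) := measure_eq_zero_iff_ae_notMem.1 (hτ x)
  filter_upwards [h1] with r hr
  have : r ≠ 0 := fun h => hr (by simp [h])
  simp [this, hx0]

lemma eq_map_smul_of_polar {m ν : Measure E} [SFinite m] {k : E → ℝ → ℝ}
    (hσ : ∀ᵐ x ∂σ, ‖x‖ = 1) (hk : ∀ x, ‖x‖ = 1 → Tendsto (k x) atTop (𝓝 0))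
    (hτ : ∀ x, (∀ a c : ℝ, 0 < a → a ≤ c → τ x (Ioc a c) = ENNReal.ofReal (k x a - k x c))
      ∧ τ x (Iic 0) = 0)
    (hν : ∀ g : E → ℝ≥0∞, Measurable g → ∫⁻ u, g u ∂ν
      = ∫⁻ x, (∫⁻ r in Ioi (0 : ℝ), g (r • x) * ENNReal.ofReal (k x r / r)) ∂σ)
    (hm : ∀ g : E → ℝ≥0∞, Measurable g → ∫⁻ u, g u ∂m = ∫⁻ x, (∫⁻ r, g (r • x) ∂(τ x)) ∂σ) :
    ν = (m.prod invMeasure).map fun p => p.2 • p.1 := by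
  refine eq_map_smul_prod_invMeasure fun g hg => ?_
  have hmeas : Measurable fun u : E =>
      ∫⁻ v in Ioo (0 : ℝ) 1, g (v • u) * ENNReal.ofReal v⁻¹ := by
    refine Measurable.lintegral_prod_right'
      (f := fun p : E × ℝ => g (p.2 • p.1) * ENNReal.ofReal p.2⁻¹) ?_
    exact (hg.comp (by fun_prop)).mul (by fun_prop)
  rw [hν g hg, hm _ hmeas]
  refine lintegral_congr_ae ?_
  filter_upwards [hσ] with x hx
  have h := lintegral_mul_ofReal_div_eq (hτ x).1 (hτ x).2 (hk x hx)
    (g := fun r => g (r • x)) (hg.comp (by fun_prop))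
  simpa only [mul_smul] using h

end Polar

end Stein

/-- Characterization of self-decomposable laws with `∫_{‖u‖≤1} ‖u‖ ν(du) < ∞`
via a Stein-type identity (`thm:caracSD1`).
Here `ν` has polar decomposition `k_x(r)/r dr σ(dx)` (hypothesis `hpolar`),
`τ x` is the Lebesgue–Stieltjes measure of the nonincreasing function `k x`
(hypothesis `hτ`) and `νt` is the measure `ν̃(du) = (−dk_x(r)) σ(dx)` (hypothesis `hνt`). -/
theorem stmt3 {d : ℕ}
    (μ ν νt : Measure (EuclideanSpace ℝ (Fin d))) [IsProbabilityMeasure μ]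
    (σ : Measure (EuclideanSpace ℝ (Fin d))) [IsFiniteMeasure σ]
    (τ : EuclideanSpace ℝ (Fin d) → Measure ℝ)
    (b : EuclideanSpace ℝ (Fin d))
    (k : EuclideanSpace ℝ (Fin d) → ℝ → ℝ)
    (hσ : σ {x : EuclideanSpace ℝ (Fin d) | ¬ ‖x‖ = 1} = 0)
    (hLevy : IsLevyMeasure ν)
    (hν1 : ∫⁻ u in {u : EuclideanSpace ℝ (Fin d) | ‖u‖ ≤ 1}, ENNReal.ofReal ‖u‖ ∂ν < ⊤)
    (hk0 : ∀ x, ∀ r : ℝ, 0 < r → 0 ≤ k x r)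
    (hkcr : ∀ x, ContinuousOn (k x) (Ioi 0))
    (hkmono : ∀ x, AntitoneOn (k x) (Ioi 0))
    (hkcx : ∀ r : ℝ, 0 < r →
      ContinuousOn (fun x => k x r) {x : EuclideanSpace ℝ (Fin d) | ‖x‖ = 1})
    (hklim0 : ∀ x, ‖x‖ = 1 → Tendsto (fun r => r * k x r) (𝓝[>] 0) (𝓝 0))
    (hkliminfty : ∀ x, ‖x‖ = 1 → Tendsto (k x) atTop (𝓝 0))
    (hkint : ∫⁻ r in Ioi (0 : ℝ),
        ENNReal.ofReal (min 1 r *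
          (⨆ x ∈ {x : EuclideanSpace ℝ (Fin d) | ‖x‖ = 1}, k x r) / r) < ⊤)
    (hpolar : ∀ g : EuclideanSpace ℝ (Fin d) → ℝ≥0∞, Measurable g →
      ∫⁻ u, g u ∂ν
        = ∫⁻ x, (∫⁻ r in Ioi (0 : ℝ), g (r • x) * ENNReal.ofReal (k x r / r)) ∂σ)
    (hvar : ∀ (xs : ℕ → EuclideanSpace ℝ (Fin d)) (x : EuclideanSpace ℝ (Fin d)),
      (∀ n, ‖xs n‖ = 1) → ‖x‖ = 1 → Tendsto xs atTop (𝓝 x) →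
      ∀ a : ℝ, 0 < a →
        Tendsto (fun n => eVariationOn (fun r => k (xs n) r - k x r) (Ici a)) atTop (𝓝 0))
    (hτ : ∀ x : EuclideanSpace ℝ (Fin d),
      (∀ a c : ℝ, 0 < a → a ≤ c → τ x (Ioc a c) = ENNReal.ofReal (k x a - k x c))
        ∧ τ x (Iic 0) = 0)
    (hνt : ∀ g : EuclideanSpace ℝ (Fin d) → ℝ≥0∞, Measurable g →
      ∫⁻ u, g u ∂νt = ∫⁻ x, (∫⁻ r, g (r • x) ∂(τ x)) ∂σ)
    (hνtint : ∫⁻ u, ENNReal.ofReal (min 1 ‖u‖) ∂νt < ⊤) :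
    (∀ f : SchwartzMap (EuclideanSpace ℝ (Fin d)) ℝ,
        ∫ x, ⟪x, gradient (⇑f) x⟫ ∂μ
          = ⟪b - ∫ u in {u : EuclideanSpace ℝ (Fin d) | ‖u‖ ≤ 1}, u ∂ν,
              ∫ x, gradient (⇑f) x ∂μ⟫
            + ∫ x, ∫ u, (f (x + u) - f x) ∂νt ∂μ)
      ↔ (∀ ξ, charFn μ ξ
          = Complex.exp (Complex.I * ((⟪b, ξ⟫ : ℝ) : ℂ)
              + ∫ u, (Complex.exp (Complex.I * ((⟪ξ, u⟫ : ℝ) : ℂ)) - 1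
                  - (if ‖u‖ ≤ 1 then Complex.I * ((⟪ξ, u⟫ : ℝ) : ℂ) else 0)) ∂ν)) := by
  have hσ' : ∀ᵐ x ∂σ, ‖x‖ = 1 := hσ
  have hm := integrable_min_of_lintegral_lt_top hνtint
  have hν := integrable_min_of_lintegral_lt_top (lintegral_min_lt_top hLevy.2 hν1)
  have : SFinite νt := sFinite_of_integrable_min
    (measure_singleton_zero_of_polar hσ' (fun x => (hτ x).2) hνt) hm
  have hmν := eq_map_smul_of_polar hσ' hkliminfty hτ hpolar hνt
  rw [← steinIdentity_iff hm]
  have hR : ∀ ξ, (charFn μ ξ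
      = Complex.exp (Complex.I * ((⟪b, ξ⟫ : ℝ) : ℂ)
          + ∫ u, (Complex.exp (Complex.I * ((⟪ξ, u⟫ : ℝ) : ℂ)) - 1
              - (if ‖u‖ ≤ 1 then Complex.I * ((⟪ξ, u⟫ : ℝ) : ℂ) else 0)) ∂ν))
      ↔ ∫ x, wave ξ x ∂μ = Complex.exp
        (levyExponent (b - ∫ u in {u : EuclideanSpace ℝ (Fin d) | ‖u‖ ≤ 1}, u ∂ν) ν ξ) :=
    fun ξ => by rw [← integral_wave_sub_one_sub_truncation hν b ξ]; rfl
  simp only [hR]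
  exact ⟨fun h => h.integral_wave_eq hm hν hmν, steinIdentity_of_integral_wave_eq hm hν hmν⟩
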